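/- arXiv:2308.04921 — 2 statements merged into one kernel-verified Lean document; each statement's English description precedes it below -/
import Mathlib

section
/- Let ρ_rp(z) = sinh(z) and let w : [0,T) → ℝ^N be any solution of the reparametrized gradient flow with w₀ = 0, A ∈ ℝ^{M×N}, y in the column span of A, ρ_link = Id, and a loss L that is continuously differentiable, convex in its first argument, with min L = 0 attained exactly on the diagonal. Then w can be extended to a maximal solution on [0,∞), the limit w̃_∞ := lim_{t→∞} sinh(w(t)) ∈ ℝ^N exists, and g_sinh(w̃_∞) = min{ g_sinh(z̃) : z̃ ∈ ℝ^N, L(A z̃, y) = 0 }, where g_sinh(z̃) = ⟨z̃, arctan(z̃)⟩ − ⟨1, ½ log(1 + z̃ ⊙ z̃)⟩ with arctan and log applied entrywise. -/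
open Filter Topology Set
open scoped ENNReal

noncomputable section

/-- Euclidean gradient of `f : ℝ^k → ℝ`: coordinatewise the Fréchet derivative applied to
the standard basis vectors. -/
def grad {k : ℕ} (f : (Fin k → ℝ) → ℝ) (x : Fin k → ℝ) : Fin k → ℝ :=
  fun i => fderiv ℝ f x (Pi.single i 1)

/-- `w` solves the gradient-flow ODE `w' = -∇F(w)` on `[0, T)`, where `T ∈ (0, ∞]` is coded
as an element of `ℝ≥0∞`. -/
def IsGradFlowOn {k : ℕ} (F : (Fin k → ℝ) → ℝ) (T : ℝ≥0∞) (w : ℝ → Fin k → ℝ) : Prop :=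
  ∀ t : ℝ, 0 ≤ t → ENNReal.ofReal t < T →
    HasDerivWithinAt w (-(grad F (w t))) (Set.Ici 0) t

/-- A reparametrized flow is regular if `ρ'` vanishes at some coordinate of `w t` for only
finitely many times `t` in the domain `[0, T)`. -/
def RegularFlow {k : ℕ} (ρ : ℝ → ℝ) (T : ℝ≥0∞) (w : ℝ → Fin k → ℝ) : Prop :=
  {t : ℝ | 0 ≤ t ∧ ENNReal.ofReal t < T ∧ ∃ i, deriv ρ (w t i) = 0}.Finite

/-- The filter of "`t → T` from within `[0,T)`", with `T = ∞` meaning `t → ∞`. -/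
def endFilter (T : ℝ≥0∞) : Filter ℝ :=
  if T = ⊤ then Filter.atTop else nhdsWithin T.toReal (Set.Iio T.toReal)

/-- Entrywise ℓp-norm on `ℝ^k`. -/
def lpNorm {k : ℕ} (p : ℝ) (z : Fin k → ℝ) : ℝ := (∑ i, |z i| ^ p) ^ (1 / p)

/-- Euclidean norm on `ℝ^k`. -/
def euclNorm {k : ℕ} (z : Fin k → ℝ) : ℝ := Real.sqrt (∑ i, (z i) ^ 2)

/-- Bregman divergence associated with `F(z) = ∑ i, H (z i)`, whose gradient is `h = H'`
applied entrywise. -/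
def bregman {k : ℕ} (H h : ℝ → ℝ) (p q : Fin k → ℝ) : ℝ :=
  (∑ i, H (p i)) - (∑ i, H (q i)) - ∑ i, h (q i) * (p i - q i)

/-- Assumption (A3) on the loss function: continuously differentiable, convex in the first
argument, with minimum `0` attained exactly on the diagonal. -/
structure LossA3 {m : ℕ} (L : (Fin m → ℝ) → (Fin m → ℝ) → ℝ) : Prop where
  contDiff : ContDiff ℝ 1 (Function.uncurry L)
  convexOn_fst : ∀ y, ConvexOn ℝ Set.univ fun z => L z y
  nonneg : ∀ z z', 0 ≤ L z z'
  eq_zero_iff : ∀ z z', L z z' = 0 ↔ z = z'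

/-- Assumption (A1) on the link function. -/
structure LinkA1 {m : ℕ} (ρlink : ℝ → ℝ) (y : Fin m → ℝ) : Prop where
  contDiff : ContDiff ℝ 1 ρlink
  injective : Function.Injective ρlink
  mem_image : ∀ j, ∃ x : ℝ, ρlink x = y j

/-- Assumption (A2) on the reparametrization `ρ : ℝ → D` with inverse `ρinv`:
continuously differentiable and invertible, derivative nonzero outside a finite set, and
`([ρ⁻¹]')²` integrable on every compact subset of `D`. -/
structure RepA2 (ρ : ℝ → ℝ) (D : Set ℝ) (ρinv : ℝ → ℝ) : Prop where
  contDiff : ContDiff ℝ 1 ρ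
  mapsTo : ∀ x : ℝ, ρ x ∈ D
  left_inv : ∀ x : ℝ, ρinv (ρ x) = x
  right_inv : ∀ z ∈ D, ρ (ρinv z) = z
  finite_critical : {x : ℝ | deriv ρ x = 0}.Finite
  loc_integrable : ∀ C : Set ℝ, C ⊆ D → IsCompact C →
    MeasureTheory.IntegrableOn (fun z => (deriv ρinv z) ^ 2) C

/-- `g_sinh(z) = ⟨z, arctan z⟩ - ⟨1, ½ log(1 + z ⊙ z)⟩`. -/
def gsinh {k : ℕ} (z : Fin k → ℝ) : ℝ :=
  (∑ i, z i * Real.arctan (z i)) - ∑ i, (1 / 2) * Real.log (1 + (z i) ^ 2)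

/-- The explicit Euler scheme with step size `h` for the autonomous equation `x' = v x`. -/
def eulerSeq {E : Type*} [AddCommGroup E] [Module ℝ E] (v : E → E) (x₀ : E) (h : ℝ) : ℕ → E
  | 0 => x₀
  | k + 1 => eulerSeq v x₀ h k + h • v (eulerSeq v x₀ h k)

theorem norm_eulerSeq_sub_le {E : Type*} [NormedAddCommGroup E] [NormedSpace ℝ E] {v : E → E}
    {x₀ : E} {h : ℝ} (hh : 0 ≤ h) {c : E} {ε : ℝ} {k j : ℕ} (hkj : k ≤ j)
    (hc : ∀ i, k ≤ i → i < j → ‖v (eulerSeq v x₀ h i) - c‖ ≤ ε) :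
    ‖eulerSeq v x₀ h j - eulerSeq v x₀ h k - (((j : ℝ) - k) * h) • c‖
      ≤ ((j : ℝ) - k) * h * ε := by
  induction j, hkj using Nat.le_induction with
  | base => simp
  | succ j hkj ih =>
    have h1 := ih fun i hi hij => hc i hi (by omega)
    have h2 : ‖h • (v (eulerSeq v x₀ h j) - c)‖ ≤ h * ε := by
      rw [norm_smul, Real.norm_of_nonneg hh]
      exact mul_le_mul_of_nonneg_left (hc j hkj (by omega)) hh
    have h3 : eulerSeq v x₀ h (j + 1) - eulerSeq v x₀ h k - ((((j + 1 : ℕ) : ℝ) - k) * h) • c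
        = (eulerSeq v x₀ h j - eulerSeq v x₀ h k - (((j : ℝ) - k) * h) • c)
          + h • (v (eulerSeq v x₀ h j) - c) := by
      simp only [eulerSeq]
      push_cast
      module
    rw [h3]
    refine (norm_add_le_of_le h1 h2).trans_eq ?_
    push_cast
    ring

theorem norm_eulerSeq_sub_le_of_bound {E : Type*} [NormedAddCommGroup E] [NormedSpace ℝ E]
    {v : E → E} {x₀ : E} {h B : ℝ} (hh : 0 ≤ h) (hB : ∀ x, ‖v x‖ ≤ B) {k j : ℕ} (hkj : k ≤ j) :
    ‖eulerSeq v x₀ h j - eulerSeq v x₀ h k‖ ≤ ((j : ℝ) - k) * h * B := by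
  simpa using norm_eulerSeq_sub_le (v := v) (x₀ := x₀) hh (c := 0) (ε := B) hkj
    fun i _ _ => by simpa using hB _

/-- Peano's existence theorem for a bounded continuous autonomous vector field on a proper
normed space: there is a solution on `[0, ∞)`. -/
theorem exists_hasDerivWithinAt_of_continuous_of_bounded {E : Type*} [NormedAddCommGroup E]
    [NormedSpace ℝ E] [ProperSpace E] {v : E → E} (hv : Continuous v) {B : ℝ}
    (hB : ∀ x, ‖v x‖ ≤ B) (x₀ : E) :
    ∃ x : ℝ → E, x 0 = x₀ ∧ ∀ t, 0 ≤ t → HasDerivWithinAt x (v (x t)) (Ici 0) t := by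
  have hB0 : 0 ≤ B := (norm_nonneg _).trans (hB x₀)
  let h : ℕ → ℝ := fun n => ((n : ℝ) + 1)⁻¹
  have hh : ∀ n, 0 ≤ h n := fun n => by positivity
  let κ : ℕ → ℝ → ℕ := fun n t => ⌊t * ((n : ℝ) + 1)⌋₊
  have hκ_mono : ∀ n {s t : ℝ}, s ≤ t → κ n s ≤ κ n t := fun n s t hst =>
    Nat.floor_mono (mul_le_mul_of_nonneg_right hst (by positivity))
  let X : ℕ → ℝ → E := fun n t => eulerSeq v x₀ (h n) (κ n t)
  let U : Ultrafilter ℕ := hyperfilter ℕ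
  have hU : (U : Filter ℕ) ≤ atTop := Nat.hyperfilter_le_atTop
  have hκ : ∀ t, 0 ≤ t → Tendsto (fun n => (κ n t : ℝ) * h n) U (𝓝 t) := by
    intro t ht
    have h1 : Tendsto (fun n : ℕ => (n : ℝ) + 1) atTop atTop :=
      tendsto_atTop_add_const_right _ _ tendsto_natCast_atTop_atTop
    exact ((tendsto_nat_floor_mul_div_atTop ht).comp h1).mono_left hU
  have hκ_sub : ∀ s t, 0 ≤ s → 0 ≤ t →
      Tendsto (fun n => ((κ n t : ℝ) - κ n s) * h n) U (𝓝 (t - s)) := fun s t hs ht => by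
    simpa only [sub_mul] using (hκ t ht).sub (hκ s hs)
  have hlim : ∀ t, ∃ p, Tendsto (fun n => X n t) U (𝓝 p) := by
    intro t
    have hmem : ∀ n, X n t ∈ Metric.closedBall x₀ (|t| * B) := by
      intro n
      rw [mem_closedBall_iff_norm]
      refine (norm_eulerSeq_sub_le_of_bound (x₀ := x₀) (hh n) hB (Nat.zero_le (κ n t))).trans ?_
      refine mul_le_mul_of_nonneg_right ?_ hB0
      have h1 : (κ n t : ℝ) ≤ |t| * ((n : ℝ) + 1) :=
        (Nat.cast_le.2 (hκ_mono n (le_abs_self t))).trans (Nat.floor_le (by positivity))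
      rw [Nat.cast_zero, sub_zero]
      exact (mul_inv_le_iff₀ (by positivity)).2 h1
    obtain ⟨p, -, hp⟩ := (isCompact_closedBall x₀ (|t| * B)).ultrafilter_le_nhds
      (U.map fun n => X n t) (le_principal_iff.2 (Ultrafilter.mem_map.2 (univ_mem' hmem)))
    exact ⟨p, hp⟩
  choose x hx using hlim
  refine ⟨x, tendsto_nhds_unique (hx 0) ?_, fun t ht => ?_⟩
  · have : (fun n => X n 0) = fun _ => x₀ := by
      funext n
      simp [X, κ, eulerSeq]
    rw [this]
    exact tendsto_const_nhds
  rw [hasDerivWithinAt_iff_isLittleO, Asymptotics.isLittleO_iff]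
  intro ε hε
  obtain ⟨δ, hδ, hvδ⟩ := Metric.continuous_iff.1 hv (x t) ε hε
  have key : ∀ a b, 0 ≤ a → a ≤ t → t ≤ b → B * (b - a) < δ / 2 →
      ‖x b - x a - (b - a) • v (x t)‖ ≤ (b - a) * ε := by
    intro a b ha hat htb hab
    have hsub := hκ_sub a b ha (ht.trans htb)
    refine le_of_tendsto_of_tendsto
      (((hx b).sub (hx a)).sub (hsub.smul_const (v (x t)))).norm (hsub.mul_const ε) ?_
    have h1 : ∀ᶠ n in (U : Filter ℕ), dist (X n t) (x t) < δ / 2 :=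
      (hx t).eventually (Metric.ball_mem_nhds _ (half_pos hδ))
    have h2 : ∀ᶠ n in (U : Filter ℕ), ((κ n b : ℝ) - κ n a) * h n * B < δ / 2 :=
      (hsub.mul_const B).eventually_lt_const (by linarith)
    filter_upwards [h1, h2] with n hn1 hn2
    refine norm_eulerSeq_sub_le (hh n) (hκ_mono n (hat.trans htb)) fun i hai hib => ?_
    rw [← dist_eq_norm]
    refine (hvδ _ ?_).le
    have h3 : dist (eulerSeq v x₀ (h n) i) (X n t) ≤ ((κ n b : ℝ) - κ n a) * h n * B := by
      have hat' : (κ n a : ℝ) ≤ κ n t := Nat.cast_le.2 (hκ_mono n hat)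
      have htb' : (κ n t : ℝ) ≤ κ n b := Nat.cast_le.2 (hκ_mono n htb)
      have hai' : (κ n a : ℝ) ≤ i := Nat.cast_le.2 hai
      have hib' : (i : ℝ) ≤ κ n b := Nat.cast_le.2 hib.le
      rcases le_total i (κ n t) with hi | hi
      · rw [dist_comm, dist_eq_norm]
        refine (norm_eulerSeq_sub_le_of_bound (hh n) hB hi).trans ?_
        have := hh n
        gcongr
      · rw [dist_eq_norm]
        refine (norm_eulerSeq_sub_le_of_bound (hh n) hB hi).trans ?_
        have := hh n
        gcongr
    linarith [dist_triangle (eulerSeq v x₀ (h n) i) (X n t) (x t)]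
  have hnear : ∀ᶠ s in 𝓝[Ici 0] t, B * |s - t| < δ / 2 := by
    refine nhdsWithin_le_nhds ?_
    have : Tendsto (fun s => B * |s - t|) (𝓝 t) (𝓝 (B * |t - t|)) :=
      Continuous.tendsto (by fun_prop) t
    exact this.eventually_lt_const (by simpa using half_pos hδ)
  filter_upwards [hnear, self_mem_nhdsWithin] with s hs hs0
  rcases le_total t s with hts | hst
  · rw [abs_of_nonneg (sub_nonneg.2 hts)] at hs
    have := key t s ht le_rfl hts hs
    rwa [Real.norm_of_nonneg (sub_nonneg.2 hts), mul_comm ε]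
  · rw [abs_of_nonpos (sub_nonpos.2 hst), neg_sub] at hs
    have := key s t hs0 hst le_rfl hs
    rw [Real.norm_of_nonpos (sub_nonpos.2 hst), neg_sub, mul_comm ε, ← norm_neg]
    have hrev : -(x s - x t - (s - t) • v (x t)) = x t - x s - (t - s) • v (x t) := by module
    rwa [hrev]

theorem grad_continuous {k : ℕ} {F : (Fin k → ℝ) → ℝ} (hF : ContDiff ℝ 1 F) :
    Continuous (grad F) :=
  continuous_pi fun _ => (hF.continuous_fderiv one_ne_zero).clm_apply continuous_const

theorem ConvexOn.fderiv_apply_sub_le {E : Type*} [NormedAddCommGroup E] [NormedSpace ℝ E]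
    {f : E → ℝ} (hf : ConvexOn ℝ univ f) {u : E} (hu : DifferentiableAt ℝ f u) (v : E) :
    fderiv ℝ f u (v - u) ≤ f v - f u := by
  have hline : ConvexOn ℝ univ (f ∘ AffineMap.lineMap (k := ℝ) u v) := by
    simpa using hf.comp_affineMap (AffineMap.lineMap (k := ℝ) u v)
  have hderiv : HasDerivAt (f ∘ AffineMap.lineMap (k := ℝ) u v) (fderiv ℝ f u (v - u)) 0 := by
    refine HasFDerivAt.comp_hasDerivAt (0 : ℝ) ?_ AffineMap.hasDerivAt_lineMap
    simpa using hu.hasFDerivAt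
  simpa [slope_def_field] using
    hline.le_slope_of_hasDerivAt (mem_univ 0) (mem_univ 1) one_pos hderiv

section SinhReparametrization

variable {N M : ℕ} {A : Matrix (Fin M) (Fin N) ℝ} {ℓ : (Fin M → ℝ) → ℝ}

theorem hasFDerivAt_sinh_pi (w : Fin N → ℝ) :
    HasFDerivAt (fun z : Fin N → ℝ => fun i => Real.sinh (z i))
      (ContinuousLinearMap.pi fun i =>
        Real.cosh (w i) • ContinuousLinearMap.proj (R := ℝ) (φ := fun _ : Fin N => ℝ) i) w :=
  hasFDerivAt_pi.2 fun i =>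
    (hasFDerivAt_apply i w).sinh

theorem contDiff_comp_mulVec_sinh (hℓ : ContDiff ℝ 1 ℓ) :
    ContDiff ℝ 1 fun z : Fin N → ℝ => ℓ (A.mulVec fun i => Real.sinh (z i)) := by
  refine hℓ.comp ((A.mulVecLin.toContinuousLinearMap).contDiff.comp ?_)
  exact contDiff_pi.2 fun i => Real.contDiff_sinh.comp (contDiff_apply ℝ ℝ i)

theorem grad_comp_mulVec_sinh (hℓ : ContDiff ℝ 1 ℓ) (w : Fin N → ℝ) (i : Fin N) :
    grad (fun z => ℓ (A.mulVec fun i => Real.sinh (z i))) w i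
      = Real.cosh (w i) *
        fderiv ℝ ℓ (A.mulVec fun i => Real.sinh (w i)) (A.mulVec (Pi.single i 1)) := by
  have h1 : HasFDerivAt (fun z : Fin N → ℝ => ℓ (A.mulVec fun i => Real.sinh (z i)))
      ((fderiv ℝ ℓ (A.mulVec fun i => Real.sinh (w i))).comp
        ((A.mulVecLin.toContinuousLinearMap).comp (ContinuousLinearMap.pi fun i =>
          Real.cosh (w i) • ContinuousLinearMap.proj (R := ℝ) (φ := fun _ : Fin N => ℝ) i))) w :=
    ((hℓ.differentiable one_ne_zero _).hasFDerivAt).comp w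
      ((A.mulVecLin.toContinuousLinearMap.hasFDerivAt).comp w (hasFDerivAt_sinh_pi w))
  have h2 : (fun j => Real.cosh (w j) * (Pi.single i 1 : Fin N → ℝ) j)
      = Real.cosh (w i) • (Pi.single i 1 : Fin N → ℝ) := by
    funext j
    rcases eq_or_ne j i with rfl | hj
    · simp
    · simp [hj]
  rw [grad, h1.fderiv]
  change fderiv ℝ ℓ _ (A.mulVec fun j => Real.cosh (w j) * (Pi.single i 1 : Fin N → ℝ) j) = _
  rw [h2, Matrix.mulVec_smul, map_smul, smul_eq_mul]

theorem sum_div_cosh_mul_grad (hℓ : ContDiff ℝ 1 ℓ) (w v : Fin N → ℝ) :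
    ∑ i, v i / Real.cosh (w i) * grad (fun z => ℓ (A.mulVec fun i => Real.sinh (z i))) w i
      = fderiv ℝ ℓ (A.mulVec fun i => Real.sinh (w i)) (A.mulVec v) := by
  have hv : A.mulVec v = ∑ i, v i • A.mulVec (Pi.single i 1) := by
    conv_lhs => rw [pi_eq_sum_univ' v]
    change A.mulVecLin _ = _
    rw [map_sum]
    refine Finset.sum_congr rfl fun i _ => ?_
    rw [map_smul]
    rfl
  rw [hv, map_sum]
  refine Finset.sum_congr rfl fun i _ => ?_
  rw [grad_comp_mulVec_sinh hℓ, map_smul, smul_eq_mul]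
  have := (Real.cosh_pos (w i)).ne'
  field_simp

/-- The Bregman divergence of `gsinh` between `z` and `sinh w`, up to the constant `gsinh z`. -/
def sinhPotential (z w : Fin N → ℝ) : ℝ :=
  ∑ i, (Real.log (Real.cosh (w i)) - z i * Real.arctan (Real.sinh (w i)))

theorem sinhPotential_zero (z : Fin N → ℝ) : sinhPotential z 0 = 0 := by
  simp [sinhPotential]

theorem continuous_sinhPotential (z : Fin N → ℝ) : Continuous (sinhPotential z) := by
  refine continuous_finsetSum _ fun i _ => Continuous.sub ?_ ?_
  · exact (Real.continuous_cosh.comp (continuous_apply i)).log fun w => (Real.cosh_pos _).ne'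
  · exact continuous_const.mul
      (Real.continuous_arctan.comp (Real.continuous_sinh.comp (continuous_apply i)))

theorem hasDerivAt_log_cosh_sub_mul_arctan_sinh (a s : ℝ) :
    HasDerivAt (fun s => Real.log (Real.cosh s) - a * Real.arctan (Real.sinh s))
      ((Real.sinh s - a) / Real.cosh s) s := by
  have hc := (Real.cosh_pos s).ne'
  have h := ((Real.hasDerivAt_cosh s).log hc).sub
    (((Real.hasDerivAt_sinh s).arctan).const_mul a)
  refine h.congr_deriv ?_
  rw [← Real.cosh_sq']
  field_simp

theorem log_cosh_sub_lt {a s : ℝ} (h : s ≠ a) :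
    Real.log (Real.cosh a) - Real.sinh a * Real.arctan (Real.sinh a)
      < Real.log (Real.cosh s) - Real.sinh a * Real.arctan (Real.sinh s) := by
  have hd := hasDerivAt_log_cosh_sub_mul_arctan_sinh (Real.sinh a)
  have hcont : Continuous
      fun s => Real.log (Real.cosh s) - Real.sinh a * Real.arctan (Real.sinh s) :=
    continuous_iff_continuousAt.2 fun s => (hd s).continuousAt
  rcases lt_or_gt_of_ne h with h | h
  · refine strictAntiOn_of_deriv_neg (convex_Iic a) hcont.continuousOn (fun x hx => ?_)
      h.le self_mem_Iic h
    rw [interior_Iic] at hx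
    rw [(hd x).deriv]
    exact div_neg_of_neg_of_pos (sub_neg.2 (Real.sinh_lt_sinh.2 hx)) (Real.cosh_pos x)
  · refine strictMonoOn_of_deriv_pos (convex_Ici a) hcont.continuousOn (fun x hx => ?_)
      self_mem_Ici h.le h
    rw [interior_Ici] at hx
    rw [(hd x).deriv]
    exact div_pos (sub_pos.2 (Real.sinh_lt_sinh.2 hx)) (Real.cosh_pos x)

theorem sinhPotential_sinh_self_le (a w : Fin N → ℝ) :
    sinhPotential (fun i => Real.sinh (a i)) a ≤ sinhPotential (fun i => Real.sinh (a i)) w := by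
  refine Finset.sum_le_sum fun i _ => ?_
  rcases eq_or_ne (w i) (a i) with h | h
  · rw [h]
  · exact (log_cosh_sub_lt h).le

theorem eq_of_sinhPotential_le {a w : Fin N → ℝ}
    (h : sinhPotential (fun i => Real.sinh (a i)) w
      ≤ sinhPotential (fun i => Real.sinh (a i)) a) : w = a := by
  by_contra hne
  obtain ⟨i, hi⟩ := Function.ne_iff.1 hne
  refine h.not_gt (Finset.sum_lt_sum (fun j _ => ?_) ⟨i, Finset.mem_univ i, log_cosh_sub_lt hi⟩)
  rcases eq_or_ne (w j) (a j) with h | h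
  · rw [h]
  · exact (log_cosh_sub_lt h).le

theorem sinhPotential_sinh_self (a : Fin N → ℝ) :
    sinhPotential (fun i => Real.sinh (a i)) a = -gsinh fun i => Real.sinh (a i) := by
  rw [sinhPotential, gsinh, Finset.sum_sub_distrib, neg_sub]
  congr 1
  refine Finset.sum_congr rfl fun i _ => ?_
  rw [← Real.cosh_sq', Real.log_pow]
  push_cast
  ring

theorem neg_gsinh_le_sinhPotential (z w : Fin N → ℝ) : -gsinh z ≤ sinhPotential z w := by
  obtain ⟨a, rfl⟩ : ∃ a : Fin N → ℝ, (fun i => Real.sinh (a i)) = z :=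
    ⟨fun i => Real.arsinh (z i), funext fun i => Real.sinh_arsinh _⟩
  rw [← sinhPotential_sinh_self]
  exact sinhPotential_sinh_self_le a w

theorem abs_le_log_cosh_add_one (x : ℝ) : |x| ≤ Real.log (Real.cosh x) + 1 := by
  have h1 : Real.exp |x| / 2 ≤ Real.cosh x := by
    rw [← Real.cosh_abs, Real.cosh_eq]
    linarith [Real.exp_pos (-|x|)]
  have h2 := Real.log_le_log (by positivity) h1
  rw [Real.log_div (Real.exp_pos _).ne' two_ne_zero, Real.log_exp] at h2
  linarith [Real.log_two_lt_d9]

theorem norm_le_sinhPotential_add (z w : Fin N → ℝ) :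
    ‖w‖ ≤ sinhPotential z w + ∑ i, (1 + 2 * |z i|) := by
  have h1 : ∀ i, |w i| ≤ Real.log (Real.cosh (w i)) - z i * Real.arctan (Real.sinh (w i))
      + (1 + 2 * |z i|) := fun i => by
    have h2 : |Real.arctan (Real.sinh (w i))| ≤ 2 :=
      abs_le.2 ⟨by linarith [Real.neg_pi_div_two_lt_arctan (Real.sinh (w i)), Real.pi_lt_four],
        by linarith [Real.arctan_lt_pi_div_two (Real.sinh (w i)), Real.pi_lt_four]⟩
    have h3 : z i * Real.arctan (Real.sinh (w i)) ≤ |z i| * 2 :=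
      (le_abs_self _).trans
        ((abs_mul _ _).trans_le (mul_le_mul_of_nonneg_left h2 (abs_nonneg _)))
    linarith [abs_le_log_cosh_add_one (w i)]
  rw [sinhPotential, ← Finset.sum_add_distrib]
  refine le_trans ?_ (Finset.sum_le_sum fun i _ => h1 i)
  refine (pi_norm_le_iff_of_nonneg (Finset.sum_nonneg fun i _ => abs_nonneg _)).2 fun i => ?_
  exact Finset.single_le_sum (f := fun i => |w i|) (fun _ _ => abs_nonneg _) (Finset.mem_univ i)

theorem hasDerivWithinAt_sinhPotential (z : Fin N → ℝ) {w : ℝ → Fin N → ℝ} {w' : Fin N → ℝ}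
    {s : Set ℝ} {t : ℝ} (hw : HasDerivWithinAt w w' s t) :
    HasDerivWithinAt (fun t => sinhPotential z (w t))
      (∑ i, (Real.sinh (w t i) - z i) / Real.cosh (w t i) * w' i) s t :=
  HasDerivWithinAt.fun_sum fun i _ => by
    have h := (hasDerivAt_log_cosh_sub_mul_arctan_sinh (z i) (w t i)).comp_hasDerivWithinAt t
      (hasDerivWithinAt_pi.1 hw i)
    exact h

theorem sum_div_cosh_mul_neg_smul_grad (hℓ : ContDiff ℝ 1 ℓ) (c : ℝ) (w v : Fin N → ℝ) :
    ∑ i, v i / Real.cosh (w i) *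
        (-(c • grad (fun z => ℓ (A.mulVec fun i => Real.sinh (z i))) w)) i
      = -c * fderiv ℝ ℓ (A.mulVec fun i => Real.sinh (w i)) (A.mulVec v) := by
  rw [← sum_div_cosh_mul_grad hℓ, Finset.mul_sum]
  refine Finset.sum_congr rfl fun i _ => ?_
  simp only [Pi.neg_apply, Pi.smul_apply, smul_eq_mul]
  ring

theorem image_sub_le_of_hasDerivWithinAt_Ici {f f' : ℝ → ℝ} {K a b : ℝ} (ha : 0 ≤ a) (hab : a ≤ b)
    (hf : ∀ t ∈ Icc a b, HasDerivWithinAt f (f' t) (Ici 0) t) (hK : ∀ t ∈ Icc a b, f' t ≤ K) :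
    f b - f a ≤ K * (b - a) := by
  have hd : ∀ t ∈ interior (Icc a b), HasDerivAt f (f' t) t := fun t ht =>
    (hf t (interior_subset ht)).hasDerivAt <| Ici_mem_nhds <| by
      rw [interior_Icc] at ht
      exact ha.trans_lt ht.1
  refine (convex_Icc a b).image_sub_le_mul_sub_of_deriv_le
    (fun t ht => ((hf t ht).mono fun s hs => ha.trans hs.1).continuousWithinAt)
    (fun t ht => (hd t ht).differentiableAt.differentiableWithinAt)
    (fun t ht => ?_) a ⟨le_rfl, hab⟩ b ⟨hab, le_rfl⟩ hab
  rw [(hd t ht).deriv]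
  exact hK t (interior_subset ht)

/-- Along a time-rescaled flow, the potential decreases at least at the rate of the
excess loss. -/
theorem sinhPotential_sub_le (hℓ : ContDiff ℝ 1 ℓ) (hconv : ConvexOn ℝ univ ℓ)
    {w : ℝ → Fin N → ℝ} {c : ℝ → ℝ} {z : Fin N → ℝ} {K a b : ℝ} (ha : 0 ≤ a) (hab : a ≤ b)
    (hc : ∀ t, 0 ≤ c t)
    (hw : ∀ t ∈ Icc a b, HasDerivWithinAt w
      (-(c t • grad (fun z => ℓ (A.mulVec fun i => Real.sinh (z i))) (w t))) (Ici 0) t)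
    (hK : ∀ t ∈ Icc a b, c t * (ℓ (A.mulVec z) - ℓ (A.mulVec fun i => Real.sinh (w t i))) ≤ K) :
    sinhPotential z (w b) - sinhPotential z (w a) ≤ K * (b - a) := by
  refine image_sub_le_of_hasDerivWithinAt_Ici ha hab
    (fun t ht => hasDerivWithinAt_sinhPotential z (hw t ht)) fun t ht => ?_
  refine le_trans ?_ (hK t ht)
  rw [sum_div_cosh_mul_neg_smul_grad hℓ (c t) (w t) fun i => Real.sinh (w t i) - z i]
  have h1 := hconv.fderiv_apply_sub_le
    (hℓ.differentiable one_ne_zero (A.mulVec fun i => Real.sinh (w t i))) (A.mulVec z)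
  have h2 : A.mulVec (fun i => Real.sinh (w t i) - z i)
      = -(A.mulVec z - A.mulVec fun i => Real.sinh (w t i)) := by
    rw [neg_sub, ← Matrix.mulVec_sub]
    rfl
  rw [h2, map_neg, neg_mul_neg]
  exact mul_le_mul_of_nonneg_left h1 (hc t)

theorem sinhPotential_le_of_mulVec_eq (hℓ : ContDiff ℝ 1 ℓ) {w : ℝ → Fin N → ℝ}
    (hw0 : w 0 = 0)
    (hw : IsGradFlowOn (fun z => ℓ (A.mulVec fun i => Real.sinh (z i))) ⊤ w)
    {z z' : Fin N → ℝ} (hz : A.mulVec z = A.mulVec z') {b : ℝ} (hb : 0 ≤ b) :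
    sinhPotential z (w b) ≤ sinhPotential z' (w b) := by
  have h := image_sub_le_of_hasDerivWithinAt_Ici (K := 0) le_rfl hb
    (fun t ht => (hasDerivWithinAt_sinhPotential z (hw t ht.1 ENNReal.ofReal_lt_top)).sub
      (hasDerivWithinAt_sinhPotential z' (hw t ht.1 ENNReal.ofReal_lt_top))) fun t _ => by
    have h1 := sum_div_cosh_mul_neg_smul_grad (A := A) hℓ 1 (w t)
    simp only [one_smul] at h1
    rw [h1 fun i => Real.sinh (w t i) - z i, h1 fun i => Real.sinh (w t i) - z' i]
    have h2 : ∀ z : Fin N → ℝ, A.mulVec (fun i => Real.sinh (w t i) - z i)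
        = (A.mulVec fun i => Real.sinh (w t i)) - A.mulVec z := fun z => by
      rw [← Matrix.mulVec_sub]
      rfl
    rw [h2 z, h2 z', hz, sub_self]
  simp only [Pi.sub_apply, hw0, sinhPotential_zero, sub_self, zero_mul, sub_zero] at h
  linarith

theorem sinhPotential_anti (hℓ : ContDiff ℝ 1 ℓ) (hconv : ConvexOn ℝ univ ℓ)
    {w : ℝ → Fin N → ℝ} {c : ℝ → ℝ} {z : Fin N → ℝ} {a b : ℝ} (ha : 0 ≤ a) (hab : a ≤ b)
    (hz : ∀ u, ℓ (A.mulVec z) ≤ ℓ u) (hc : ∀ t, 0 ≤ c t)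
    (hw : ∀ t ∈ Icc a b, HasDerivWithinAt w
      (-(c t • grad (fun z => ℓ (A.mulVec fun i => Real.sinh (z i))) (w t))) (Ici 0) t) :
    sinhPotential z (w b) ≤ sinhPotential z (w a) := by
  have h := sinhPotential_sub_le (K := 0) hℓ hconv ha hab hc hw fun t _ =>
    mul_nonpos_of_nonneg_of_nonpos (hc t) (sub_nonpos.2 (hz _))
  linarith

/-- A `sinh`-reparametrized gradient flow started at `0` converges to the minimizer of `gsinh`
among the minimizers of the loss. -/
theorem exists_tendsto_of_isGradFlowOn_top (hℓ : ContDiff ℝ 1 ℓ) (hconv : ConvexOn ℝ univ ℓ)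
    (hnonneg : ∀ u, 0 ≤ ℓ u) {y : Fin M → ℝ} (hzero : ∀ u, ℓ u = 0 ↔ u = y)
    {z₀ : Fin N → ℝ} (hz₀ : A.mulVec z₀ = y) {w : ℝ → Fin N → ℝ} (hw0 : w 0 = 0)
    (hw : IsGradFlowOn (fun z => ℓ (A.mulVec fun i => Real.sinh (z i))) ⊤ w) :
    ∃ a : Fin N → ℝ, Tendsto w atTop (𝓝 a) ∧ (A.mulVec fun i => Real.sinh (a i)) = y ∧
      ∀ z, A.mulVec z = y → gsinh (fun i => Real.sinh (a i)) ≤ gsinh z := by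
  have hw1 : ∀ t, 0 ≤ t → HasDerivWithinAt w
      (-((1 : ℝ) • grad (fun z => ℓ (A.mulVec fun i => Real.sinh (z i))) (w t))) (Ici 0) t :=
    fun t ht => by simpa only [one_smul] using hw t ht ENNReal.ofReal_lt_top
  have hmin : ∀ z, A.mulVec z = y → ℓ (A.mulVec z) = 0 := fun z hz => (hzero _).2 hz
  have hanti : ∀ z, A.mulVec z = y → ∀ s t, 0 ≤ s → s ≤ t →
      sinhPotential z (w t) ≤ sinhPotential z (w s) := fun z hz s t hs hst =>
    sinhPotential_anti (c := fun _ => 1) hℓ hconv hs hst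
      (fun u => (hmin z hz).trans_le (hnonneg u)) (fun _ => zero_le_one)
      fun r hr => hw1 r (hs.trans hr.1)
  have hbdd : ∀ t, 0 ≤ t → w t ∈ Metric.closedBall 0 (∑ i, (1 + 2 * |z₀ i|)) := fun t ht => by
    have h1 := hanti z₀ hz₀ 0 t le_rfl ht
    rw [hw0, sinhPotential_zero] at h1
    rw [mem_closedBall_zero_iff]
    linarith [norm_le_sinhPotential_add z₀ (w t)]
  have hsmall : ∀ n : ℕ, ∃ t : ℝ, (n : ℝ) ≤ t ∧
      ℓ (A.mulVec fun i => Real.sinh (w t i)) ≤ 1 / ((n : ℝ) + 1) := by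
    intro n
    by_contra! hn
    have hε : 0 < 1 / ((n : ℝ) + 1) := by positivity
    set ε := 1 / ((n : ℝ) + 1)
    have hlow := neg_gsinh_le_sinhPotential z₀
    have hs : 0 ≤ (sinhPotential z₀ (w n) + gsinh z₀ + 1) / ε :=
      div_nonneg (by linarith [hlow (w n)]) hε.le
    have h := sinhPotential_sub_le (A := A) (c := fun _ => 1) (z := z₀) (K := -ε) hℓ hconv
      n.cast_nonneg (le_add_of_nonneg_right hs) (fun _ => zero_le_one)
      (fun r hr => hw1 r (n.cast_nonneg.trans hr.1)) fun r hr => by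
        rw [hmin z₀ hz₀]
        linarith [hn r hr.1]
    rw [add_sub_cancel_left, neg_mul, mul_div_cancel₀ _ hε.ne'] at h
    linarith [hlow (w (n + (sinhPotential z₀ (w n) + gsinh z₀ + 1) / ε))]
  choose τ hτn hτ using hsmall
  have hτ0 : ∀ n, 0 ≤ τ n := fun n => n.cast_nonneg.trans (hτn n)
  obtain ⟨a, -, φ, hφ, hφa⟩ := tendsto_subseq_of_bounded Metric.isBounded_closedBall
    fun n => hbdd (τ n) (hτ0 n)
  have ha : (A.mulVec fun i => Real.sinh (a i)) = y := by
    rw [← hzero]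
    refine le_antisymm (le_of_tendsto_of_tendsto
      (((contDiff_comp_mulVec_sinh (A := A) hℓ).continuous.tendsto a).comp hφa)
      (tendsto_one_div_add_atTop_nhds_zero_nat.comp hφ.tendsto_atTop)
      (Eventually.of_forall fun n => hτ (φ n))) (hnonneg _)
  have hwa : Tendsto w atTop (𝓝 a) := by
    refine (isCompact_closedBall (0 : Fin N → ℝ) _).tendsto_nhds_of_unique_mapClusterPt
      ((eventually_ge_atTop 0).mono hbdd) fun p _ hp => eq_of_sinhPotential_le ?_
    have hcont := continuous_sinhPotential fun i => Real.sinh (a i)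
    have hev : ∀ n, ∀ᶠ t in atTop, w t ∈
        {q | sinhPotential (fun i => Real.sinh (a i)) q
          ≤ sinhPotential (fun i => Real.sinh (a i)) (w (τ n))} := fun n =>
      (eventually_ge_atTop (τ n)).mono fun t ht => hanti _ ha _ _ (hτ0 n) ht
    refine ge_of_tendsto ((hcont.tendsto a).comp hφa) (Eventually.of_forall fun n => ?_)
    exact (isClosed_le hcont continuous_const).mem_of_mapClusterPt hp (hev (φ n))
  refine ⟨a, hwa, ha, fun z hz => ?_⟩
  have h1 : sinhPotential z a ≤ sinhPotential (fun i => Real.sinh (a i)) a :=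
    le_of_tendsto_of_tendsto (((continuous_sinhPotential z).tendsto a).comp hwa)
      (((continuous_sinhPotential _).tendsto a).comp hwa)
      ((eventually_ge_atTop 0).mono fun t ht =>
        sinhPotential_le_of_mulVec_eq hℓ hw0 hw (hz.trans ha.symm) ht)
  rw [sinhPotential_sinh_self] at h1
  linarith [neg_gsinh_le_sinhPotential z a]

/-- Global existence for the `sinh`-reparametrized gradient flow. -/
theorem exists_isGradFlowOn_top (hℓ : ContDiff ℝ 1 ℓ) (hconv : ConvexOn ℝ univ ℓ)
    {z : Fin N → ℝ} (hz : ∀ u, ℓ (A.mulVec z) ≤ ℓ u) (p : Fin N → ℝ) :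
    ∃ x : ℝ → Fin N → ℝ, x 0 = p ∧
      IsGradFlowOn (fun z => ℓ (A.mulVec fun i => Real.sinh (z i))) ⊤ x := by
  set F : (Fin N → ℝ) → ℝ := fun z => ℓ (A.mulVec fun i => Real.sinh (z i))
  have hgrad : Continuous (grad F) := grad_continuous (contDiff_comp_mulVec_sinh hℓ)
  set R : ℝ := sinhPotential z p + ∑ i, (1 + 2 * |z i|)
  have hR : 0 ≤ R := (norm_nonneg p).trans (norm_le_sinhPotential_add z p)
  let χ : (Fin N → ℝ) → ℝ := fun q => max 0 (min 1 (R + 1 - ‖q‖))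
  have hχ : Continuous χ := by fun_prop
  obtain ⟨C, hC⟩ := (isCompact_closedBall (0 : Fin N → ℝ) (R + 1)).exists_bound_of_continuousOn
    hgrad.continuousOn
  have hC0 : 0 ≤ C := (norm_nonneg _).trans (hC 0 (Metric.mem_closedBall_self (by linarith)))
  have hbound : ∀ q, ‖-(χ q • grad F q)‖ ≤ C := by
    intro q
    have h0 : 0 ≤ χ q := le_max_left _ _
    rw [norm_neg, norm_smul, Real.norm_of_nonneg h0]
    rcases le_total ‖q‖ (R + 1) with hq | hq
    · have h1 : χ q ≤ 1 := max_le zero_le_one (min_le_left _ _)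
      exact (mul_le_of_le_one_left (norm_nonneg _) h1).trans (hC q (mem_closedBall_zero_iff.2 hq))
    · have h1 : χ q = 0 := max_eq_left ((min_le_right _ _).trans (by linarith))
      rwa [h1, zero_mul]
  obtain ⟨x, hx0, hx⟩ := exists_hasDerivWithinAt_of_continuous_of_bounded
    (hχ.smul hgrad).neg hbound p
  refine ⟨x, hx0, fun t ht _ => ?_⟩
  have h1 := sinhPotential_anti (c := fun t => χ (x t)) hℓ hconv le_rfl ht hz
    (fun t => le_max_left _ _) fun s hs => hx s hs.1
  rw [hx0] at h1
  have hχ1 : χ (x t) = 1 := by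
    have h2 : ‖x t‖ ≤ R :=
      (norm_le_sinhPotential_add z (x t)).trans (by simpa only [R, add_le_add_iff_right] using h1)
    have h3 : min 1 (R + 1 - ‖x t‖) = 1 := min_eq_left (by linarith)
    simp only [χ, h3, zero_le_one, max_eq_right]
  have h4 : HasDerivWithinAt x (-(χ (x t) • grad F (x t))) (Ici 0) t := hx t ht
  rwa [hχ1, one_smul] at h4

end SinhReparametrization

/-- A bounded gradient flow on `[0, τ)` agrees there with a continuous function. -/
theorem exists_continuous_eqOn_of_gradFlow {k : ℕ} {F : (Fin k → ℝ) → ℝ}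
    (hF : ContDiff ℝ 1 F) {τ : ℝ} {w : ℝ → Fin k → ℝ}
    (hw : ∀ t, 0 ≤ t → t < τ → HasDerivWithinAt w (-(grad F (w t))) (Ici 0) t) {R : ℝ}
    (hR : ∀ t, 0 ≤ t → t < τ → ‖w t‖ ≤ R) :
    ∃ g : ℝ → Fin k → ℝ, Continuous g ∧ EqOn w g (Ico 0 τ) := by
  obtain ⟨C, hC⟩ := (isCompact_closedBall (0 : Fin k → ℝ) R).exists_bound_of_continuousOn
    (grad_continuous hF).continuousOn
  have hlip : LipschitzOnWith C.toNNReal w (Ico 0 τ) := by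
    refine (convex_Ico 0 τ).lipschitzOnWith_of_nnnorm_hasDerivWithin_le
      (fun t ht => (hw t ht.1 ht.2).mono Ico_subset_Ici_self) fun t ht => ?_
    rw [nnnorm_neg]
    exact NNReal.le_toNNReal_of_coe_le (hC _ (mem_closedBall_zero_iff.2 (hR t ht.1 ht.2)))
  obtain ⟨g, hg, hwg⟩ := hlip.extend_pi
  exact ⟨g, hg.continuous, hwg⟩

/-- A gradient flow on `[0, τ)` which extends continuously to `τ` can be continued by a global
flow started at the limit point. -/
theorem isGradFlowOn_concat {k : ℕ} {F : (Fin k → ℝ) → ℝ} (hF : ContDiff ℝ 1 F) {τ : ℝ}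
    (hτ : 0 < τ) {w g x : ℝ → Fin k → ℝ}
    (hw : ∀ t, 0 ≤ t → t < τ → HasDerivWithinAt w (-(grad F (w t))) (Ici 0) t)
    (hg : Continuous g) (hwg : EqOn w g (Ico 0 τ)) (hx : IsGradFlowOn F ⊤ x) (hx0 : x 0 = g τ) :
    IsGradFlowOn F ⊤ fun t => if t < τ then w t else x (t - τ) := by
  intro t ht _
  rcases lt_or_ge t τ with htτ | htτ
  · have heq : (fun t => if t < τ then w t else x (t - τ)) =ᶠ[𝓝 t] w :=
      (eventually_lt_nhds htτ).mono fun s hs => if_pos hs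
    simp only [if_pos htτ]
    exact (hw t ht htτ).congr_of_eventuallyEq (heq.filter_mono nhdsWithin_le_nhds) heq.eq_of_nhds
  simp only [if_neg htτ.not_gt]
  have hright : HasDerivWithinAt (fun t => if t < τ then w t else x (t - τ))
      (-(grad F (x (t - τ)))) (Ici τ) t := by
    have h1 := (hx (t - τ) (sub_nonneg.2 htτ) ENNReal.ofReal_lt_top).scomp t
      (((hasDerivAt_id t).sub_const τ).hasDerivWithinAt (s := Ici τ))
      fun s (hs : τ ≤ s) => sub_nonneg.2 hs
    rw [one_smul] at h1
    exact h1.congr (fun s hs => if_neg (not_lt.2 hs)) (if_neg htτ.not_gt)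
  rcases htτ.eq_or_lt with rfl | htτ
  · have hd : ∀ s ∈ Ioo 0 τ, HasDerivAt g (-(grad F (g s))) s := fun s hs => by
      have h1 := (hw s hs.1.le hs.2).hasDerivAt (Ici_mem_nhds hs.1)
      have heq : g =ᶠ[𝓝 s] w := eventually_of_mem (Ioo_mem_nhds hs.1 hs.2) fun r hr =>
        (hwg ⟨hr.1.le, hr.2⟩).symm
      rw [heq.eq_of_nhds]
      exact h1.congr_of_eventuallyEq heq
    have hmem : Ioo 0 τ ∈ 𝓝[<] τ := Ioo_mem_nhdsLT hτ
    have hleft : HasDerivWithinAt g (-(grad F (g τ))) (Iic τ) τ := by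
      refine hasDerivWithinAt_Iic_of_tendsto_deriv
        (fun s hs => (hd s hs).differentiableAt.differentiableWithinAt)
        hg.continuousWithinAt hmem ?_
      refine Tendsto.congr' (eventually_of_mem hmem fun s hs => (hd s hs).deriv.symm) ?_
      exact (((grad_continuous hF).comp hg).neg.tendsto τ).mono_left nhdsWithin_le_nhds
    have heq : (fun t => if t < τ then w t else x (t - τ)) =ᶠ[𝓝[Iic τ] τ] g := by
      filter_upwards [self_mem_nhdsWithin, nhdsWithin_le_nhds (eventually_gt_nhds hτ)] with s hs hs0
      rcases (show s ≤ τ from hs).eq_or_lt with rfl | hs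
      · simp [hx0]
      · simp only [if_pos hs]
        exact hwg ⟨hs0.le, hs⟩
    have hleft' := hleft.congr_of_eventuallyEq heq (by simp [hx0])
    rw [sub_self, hx0] at hright ⊢
    have h := hleft'.union hright
    rw [Iic_union_Ici] at h
    exact h.mono (subset_univ _)
  · exact (hright.hasDerivAt (Ici_mem_nhds htτ)).hasDerivWithinAt

/-- Implicit bias of `sinh`-reparametrized gradient flow started at `0`. -/
theorem statement1 {N M : ℕ} (A : Matrix (Fin M) (Fin N) ℝ) (y : Fin M → ℝ)
    (L : (Fin M → ℝ) → (Fin M → ℝ) → ℝ) (hA3 : LossA3 L)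
    (hy : ∃ z : Fin N → ℝ, A.mulVec z = y)
    (T : ℝ≥0∞) (hT : 0 < T) (w : ℝ → Fin N → ℝ) (hw0 : w 0 = 0)
    (hflow : IsGradFlowOn (fun z => L (A.mulVec fun i => Real.sinh (z i)) y) T w) :
    ∃ w2 : ℝ → Fin N → ℝ,
      IsGradFlowOn (fun z => L (A.mulVec fun i => Real.sinh (z i)) y) ⊤ w2 ∧
      (∀ t : ℝ, 0 ≤ t → ENNReal.ofReal t < T → w2 t = w t) ∧
      ∃ winf : Fin N → ℝ,
        Tendsto (fun t => fun i => Real.sinh (w2 t i)) atTop (𝓝 winf) ∧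
        L (A.mulVec winf) y = 0 ∧
        ∀ z : Fin N → ℝ, L (A.mulVec z) y = 0 → gsinh winf ≤ gsinh z := by
  obtain ⟨z₀, hz₀⟩ := hy
  have hℓ : ContDiff ℝ 1 fun u => L u y := hA3.contDiff.comp (contDiff_id.prodMk contDiff_const)
  have hconv := hA3.convexOn_fst y
  have hnonneg : ∀ u, 0 ≤ L u y := fun u => hA3.nonneg u y
  have hzero : ∀ u, L u y = 0 ↔ u = y := fun u => hA3.eq_zero_iff u y
  have hmin : ∀ u, L (A.mulVec z₀) y ≤ L u y := fun u =>
    ((hzero _).2 hz₀).trans_le (hnonneg u)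
  suffices h : ∃ w2 : ℝ → Fin N → ℝ,
      IsGradFlowOn (fun z => L (A.mulVec fun i => Real.sinh (z i)) y) ⊤ w2 ∧
      ∀ t : ℝ, 0 ≤ t → ENNReal.ofReal t < T → w2 t = w t by
    obtain ⟨w2, hw2, heq⟩ := h
    have hw20 : w2 0 = 0 := by rw [heq 0 le_rfl (by simpa using hT), hw0]
    obtain ⟨a, ha, hAa, hga⟩ := exists_tendsto_of_isGradFlowOn_top (ℓ := fun u => L u y)
      hℓ hconv hnonneg hzero hz₀ hw20 hw2
    refine ⟨w2, hw2, heq, fun i => Real.sinh (a i), ?_, (hzero _).2 hAa,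
      fun z hz => hga z ((hzero _).1 hz)⟩
    exact ((continuous_pi fun i =>
      Real.continuous_sinh.comp (continuous_apply i)).tendsto a).comp ha
  rcases eq_or_ne T ⊤ with rfl | hTtop
  · exact ⟨w, hflow, fun _ _ _ => rfl⟩
  have hlt : ∀ t : ℝ, 0 ≤ t → (ENNReal.ofReal t < T ↔ t < T.toReal) := fun t ht =>
    ENNReal.ofReal_lt_iff_lt_toReal ht hTtop
  have hw := fun t ht htT => hflow t ht ((hlt t ht).2 htT)
  have hbdd : ∀ t, 0 ≤ t → t < T.toReal → ‖w t‖ ≤ ∑ i, (1 + 2 * |z₀ i|) := fun t ht htT => by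
    have h1 := sinhPotential_anti (ℓ := fun u => L u y) (c := fun _ => 1) hℓ hconv le_rfl ht hmin
      (fun _ => zero_le_one) fun s hs => by
        simpa only [one_smul] using hw s hs.1 (hs.2.trans_lt htT)
    rw [hw0, sinhPotential_zero] at h1
    linarith [norm_le_sinhPotential_add z₀ (w t)]
  have hF := contDiff_comp_mulVec_sinh (A := A) hℓ
  obtain ⟨g, hg, hwg⟩ := exists_continuous_eqOn_of_gradFlow hF hw hbdd
  obtain ⟨x, hx0, hx⟩ := exists_isGradFlowOn_top (ℓ := fun u => L u y) hℓ hconv hmin (g T.toReal)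
  exact ⟨_, isGradFlowOn_concat hF (ENNReal.toReal_pos hT.ne' hTtop) hw hg hwg hx hx0,
    fun t ht htT => if_pos ((hlt t ht).1 htT)⟩
end
end

section
/- Let w : [0,T) → ℝ^N with T ∈ (0,∞] be a regular reparametrized gradient flow under Assumptions (A1), (A2), (A3). Let h : D_rp → ℝ be a continuous antiderivative of h'(z̃) = ([ρ_rp^{-1}]'(z̃))² and H : D_rp → ℝ a continuous antiderivative of h. Suppose the limit w_T := lim_{t→T} w(t) exists and satisfies 𝓛(w_T) = 0, and that at least one of the following holds: (i) w̃_T := ρ_rp(w_T) ∈ D_rp^N, or (ii) the continuous extensions of h and H to the closure of D_rp are well-defined and finite-valued. Then w̃_T minimizes the objective z̃ ↦ ⟨1, H(z̃) − z̃ ⊙ h(w̃₀)⟩ over the set {z̃ ∈ closure(D_rp)^N : 𝓛̃(z̃) = 0} (H applied entrywise, extended by continuity to the closure). Moreover, with F(z̃) := ⟨1, H(z̃)⟩ and D_F the associated Bregman divergence (extended to closure(D_rp)^N by continuity, with +∞ admissible), minimizing this objective over {z̃ ∈ closure(D_rp)^N : 𝓛̃(z̃) = 0} is equivalent to minimizing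 D_F(z̃, w̃₀): the two problems have the same set of global minimizers. -/
open Filter Topology Set
open scoped ENNReal

noncomputable section

/-- The derivative of a function that is differentiable on a punctured neighbourhood of `x`
extends to `x` by continuity. -/
theorem hasDerivAt_of_eventually_hasDerivAt_punctured {f g : ℝ → ℝ} {x : ℝ}
    (f_diff : ∀ᶠ y in 𝓝[≠] x, HasDerivAt f (g y) y) (hf : ContinuousAt f x)
    (hg : ContinuousAt g x) : HasDerivAt f (g x) x := by
  have hgt := f_diff.filter_mono (nhdsWithin_mono x fun _ hy => ne_of_gt hy)
  have hlt := f_diff.filter_mono (nhdsWithin_mono x fun _ hy => ne_of_lt hy)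
  have A : HasDerivWithinAt f (g x) (Ici x) x :=
    hasDerivWithinAt_Ici_of_tendsto_deriv (s := {y | HasDerivAt f (g y) y})
      (fun y hy => hy.differentiableAt.differentiableWithinAt) hf.continuousWithinAt hgt
      ((tendsto_inf_left hg).congr' (hgt.mono fun y hy => hy.deriv.symm))
  have B : HasDerivWithinAt f (g x) (Iic x) x :=
    hasDerivWithinAt_Iic_of_tendsto_deriv (s := {y | HasDerivAt f (g y) y})
      (fun y hy => hy.differentiableAt.differentiableWithinAt) hf.continuousWithinAt hlt
      ((tendsto_inf_left hg).congr' (hlt.mono fun y hy => hy.deriv.symm))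
  simpa using B.union A

namespace RepA2

variable {ρ ρinv : ℝ → ℝ} {D : Set ℝ}

theorem range_eq (hA2 : RepA2 ρ D ρinv) : range ρ = D :=
  Subset.antisymm (range_subset_iff.2 hA2.mapsTo) fun z hz => ⟨ρinv z, hA2.right_inv z hz⟩

theorem ordConnected (hA2 : RepA2 ρ D ρinv) : D.OrdConnected :=
  hA2.range_eq ▸ (isPreconnected_range hA2.contDiff.continuous).ordConnected

theorem hasDerivAt (hA2 : RepA2 ρ D ρinv) (x : ℝ) : HasDerivAt ρ (deriv ρ x) x :=
  (hA2.contDiff.differentiable one_ne_zero x).hasDerivAt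

theorem deriv_inv (hA2 : RepA2 ρ D ρinv) {x : ℝ} (hx : deriv ρ x ≠ 0) :
    deriv ρinv (ρ x) = (deriv ρ x)⁻¹ :=
  ((hA2.contDiff.contDiffAt.hasStrictDerivAt one_ne_zero).to_local_left_inverse hx
    (Eventually.of_forall hA2.left_inv)).hasDerivAt.deriv

/-- If `h' = ((ρ⁻¹)')²` on `D` up to finitely many points, then `(h ∘ ρ)' = 1 / ρ'` wherever `ρ'`
does not vanish. -/
theorem hasDerivAt_comp (hA2 : RepA2 ρ D ρinv) {h : ℝ → ℝ} {S : Set ℝ} (hS : S.Finite)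
    (hcont : ContinuousOn h D)
    (hderiv : ∀ z ∈ D \ S, HasDerivWithinAt h ((deriv ρinv z) ^ 2) D z)
    {x : ℝ} (hx : deriv ρ x ≠ 0) :
    HasDerivAt (fun x => h (ρ x)) (deriv ρ x)⁻¹ x := by
  have hρ' : Continuous (deriv ρ) := hA2.contDiff.continuous_deriv le_rfl
  refine hasDerivAt_of_eventually_hasDerivAt_punctured (g := fun x => (deriv ρ x)⁻¹) ?_
    (hcont.comp_continuous hA2.contDiff.continuous hA2.mapsTo).continuousAt
    (hρ'.continuousAt.inv₀ hx)
  have hinj : Function.Injective ρ := Function.LeftInverse.injective hA2.left_inv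
  have hfin : ((ρ ⁻¹' S) \ {x}).Finite := (hS.preimage hinj.injOn).sdiff
  have hne : ∀ᶠ y in 𝓝[≠] x, y ∉ (ρ ⁻¹' S) \ {x} :=
    nhdsWithin_le_nhds (hfin.isClosed.isOpen_compl.mem_nhds fun hmem => hmem.2 rfl)
  filter_upwards [hne, nhdsWithin_le_nhds (hρ'.continuousAt.eventually_ne hx), self_mem_nhdsWithin]
    with y hyS hy hyx
  have hd := (hderiv (ρ y) ⟨hA2.mapsTo y, fun hm => hyS ⟨hm, hyx⟩⟩).comp_hasDerivAt y
    (hA2.hasDerivAt y) (Eventually.of_forall hA2.mapsTo)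
  rwa [hA2.deriv_inv hy, pow_two, inv_mul_cancel_right₀ hy] at hd

theorem monotoneOn (hA2 : RepA2 ρ D ρinv) {h : ℝ → ℝ} {S : Set ℝ} (hS : S.Finite)
    (hcont : ContinuousOn h D)
    (hderiv : ∀ z ∈ D \ S, HasDerivWithinAt h ((deriv ρinv z) ^ 2) D z) :
    MonotoneOn h D := by
  intro a ha b hb hab
  have hsub : Icc a b ⊆ D := hA2.ordConnected.out ha hb
  have hint := MeasureTheory.integral_eq_of_hasDerivAt_off_countable_of_le h
    (fun z => (deriv ρinv z) ^ 2) hab hS.countable (hcont.mono hsub)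
    (fun z hz => (hderiv z ⟨hsub (Ioo_subset_Icc_self hz.1), hz.2⟩).hasDerivAt
      (mem_of_superset (Icc_mem_nhds hz.1.1 hz.1.2) hsub))
    ((intervalIntegrable_iff_integrableOn_Icc_of_le hab).2
      (hA2.loc_integrable _ hsub isCompact_Icc))
  have hnn : 0 ≤ ∫ z in a..b, (deriv ρinv z) ^ 2 :=
    intervalIntegral.integral_nonneg hab fun z _ => sq_nonneg _
  linarith

end RepA2

/-- Tangent line inequality for a function with monotone derivative on an interval. -/
theorem MonotoneOn.tangent_le {D : Set ℝ} (hD : D.OrdConnected) {H h : ℝ → ℝ}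
    (hmono : MonotoneOn h D) (hderiv : ∀ z ∈ D, HasDerivWithinAt H (h z) D z)
    {q z : ℝ} (hq : q ∈ D) (hz : z ∈ D) : H q + h q * (z - q) ≤ H z := by
  have slope : ∀ a ∈ D, ∀ b ∈ D, a < b → ∃ c ∈ D, a ≤ c ∧ c ≤ b ∧ H b - H a = h c * (b - a) := by
    intro a ha b hb hab
    have hsub : Icc a b ⊆ D := hD.out ha hb
    obtain ⟨c, hc, hceq⟩ := exists_hasDerivAt_eq_slope H h hab
      (fun x hx => (hderiv x (hsub hx)).continuousWithinAt.mono hsub)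
      (fun x hx => (hderiv x (hsub (Ioo_subset_Icc_self hx))).hasDerivAt
        (mem_of_superset (Icc_mem_nhds hx.1 hx.2) hsub))
    refine ⟨c, hsub (Ioo_subset_Icc_self hc), hc.1.le, hc.2.le, ?_⟩
    rw [hceq, div_mul_cancel₀ _ (sub_pos.2 hab).ne']
  rcases lt_trichotomy q z with hlt | rfl | hlt
  · obtain ⟨c, hcD, hqc, -, hceq⟩ := slope q hq z hz hlt
    nlinarith [hmono hq hcD hqc]
  · simp
  · obtain ⟨c, hcD, -, hcq, hceq⟩ := slope z hz q hq hlt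
    nlinarith [hmono hcD hq hcq]

/-- The tangent line inequality passes to the extended-valued continuous extension. -/
theorem tangent_le_of_tendsto {D : Set ℝ} {H : ℝ → ℝ} {Hbar : ℝ → EReal} {a b q : ℝ}
    (hle : ∀ z ∈ D, a + b * (z - q) ≤ H z) {x : ℝ} (hx : x ∈ closure D)
    (hlim : Tendsto (fun z => ((H z : ℝ) : EReal)) (𝓝[D] x) (𝓝 (Hbar x))) :
    ((a + b * (x - q) : ℝ) : EReal) ≤ Hbar x := by
  have := mem_closure_iff_nhdsWithin_neBot.1 hx
  have hline : Tendsto (fun z => ((a + b * (z - q) : ℝ) : EReal)) (𝓝[D] x)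
      (𝓝 ((a + b * (x - q) : ℝ) : EReal)) :=
    ((continuous_coe_real_ereal.comp (by fun_prop :
      Continuous fun z : ℝ => a + b * (z - q))).tendsto x).mono_left nhdsWithin_le_nhds
  refine le_of_tendsto_of_tendsto hline hlim ?_
  filter_upwards [self_mem_nhdsWithin] with z hz
  exact EReal.coe_le_coe_iff.2 (hle z hz)

theorem sum_mul_grad {k : ℕ} (f : (Fin k → ℝ) → ℝ) (x u : Fin k → ℝ) :
    ∑ i, u i * grad f x i = fderiv ℝ f x u := by
  conv_rhs => rw [← Finset.univ_sum_single u, map_sum]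
  refine Finset.sum_congr rfl fun i _ => ?_
  rw [grad, ← smul_eq_mul, ← map_smul, ← Pi.single_smul, smul_eq_mul, mul_one]

theorem grad_comp_entrywise {k : ℕ} {G : (Fin k → ℝ) → ℝ} {ρ : ℝ → ℝ} (z : Fin k → ℝ)
    (hG : DifferentiableAt ℝ G fun i => ρ (z i)) (hρ : ∀ i, DifferentiableAt ℝ ρ (z i))
    (i : Fin k) :
    grad (fun z => G fun i => ρ (z i)) z i = deriv ρ (z i) * grad G (fun i => ρ (z i)) i := by
  have hin : HasFDerivAt (fun z : Fin k → ℝ => fun i => ρ (z i))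
      (ContinuousLinearMap.pi fun i =>
        (deriv ρ (z i)) • (ContinuousLinearMap.proj i : (Fin k → ℝ) →L[ℝ] ℝ)) z :=
    hasFDerivAt_pi.2 fun i =>
      (hρ i).hasDerivAt.comp_hasFDerivAt z (hasFDerivAt_apply i z)
  have hcomp := hG.hasFDerivAt.comp z hin
  have hvec : (ContinuousLinearMap.pi fun i =>
        (deriv ρ (z i)) • (ContinuousLinearMap.proj i : (Fin k → ℝ) →L[ℝ] ℝ))
      (Pi.single i 1) = deriv ρ (z i) • (Pi.single i 1 : Fin k → ℝ) := by
    ext j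
    rcases eq_or_ne j i with rfl | hji <;> simp [*]
  calc grad (fun z => G fun i => ρ (z i)) z i
      = fderiv ℝ G (fun i => ρ (z i)) ((ContinuousLinearMap.pi fun i =>
        (deriv ρ (z i)) • (ContinuousLinearMap.proj i : (Fin k → ℝ) →L[ℝ] ℝ))
          (Pi.single i 1)) := congrArg (fun φ => φ (Pi.single i 1)) hcomp.fderiv
    _ = _ := by rw [hvec, map_smul, smul_eq_mul, grad]

theorem fderiv_comp_mulVec_eq_zero {m n : ℕ} {K : (Fin m → ℝ) → ℝ} (A : Matrix (Fin m) (Fin n) ℝ)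
    (x u : Fin n → ℝ) (hK : DifferentiableAt ℝ K (A.mulVec x)) (hu : A.mulVec u = 0) :
    fderiv ℝ (fun z => K (A.mulVec z)) x u = 0 := by
  have hcomp := hK.hasFDerivAt.comp x (Matrix.mulVecLin A).toContinuousLinearMap.hasFDerivAt
  calc fderiv ℝ (fun z => K (A.mulVec z)) x u
      = fderiv ℝ K (A.mulVec x) (A.mulVec u) := congrArg (fun φ => φ u) hcomp.fderiv
    _ = 0 := by rw [hu, map_zero]

theorem endFilter_neBot (T : ℝ≥0∞) : (endFilter T).NeBot := by
  unfold endFilter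
  split_ifs <;> infer_instance

theorem eventually_endFilter {T : ℝ≥0∞} (hT : 0 < T) :
    ∀ᶠ t in endFilter T, 0 ≤ t ∧ ENNReal.ofReal t < T := by
  unfold endFilter
  split_ifs with htop
  · filter_upwards [eventually_ge_atTop 0] with t ht
    exact ⟨ht, htop ▸ ENNReal.ofReal_lt_top⟩
  · have hpos : 0 < T.toReal := ENNReal.toReal_pos hT.ne' htop
    filter_upwards [self_mem_nhdsWithin, nhdsWithin_le_nhds (Ioi_mem_nhds hpos)] with t ht ht0
    exact ⟨le_of_lt ht0, (ENNReal.ofReal_lt_iff_lt_toReal (le_of_lt ht0) htop).2 ht⟩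

/-- A reparametrized gradient flow of `z̃ ↦ K (A z̃)` conserves the pairing of `h (ρ (w t))` with
any vector in the kernel of `A`. -/
theorem sum_mul_mirror_eq {N M : ℕ} {ρ ρinv : ℝ → ℝ} {D : Set ℝ} (hA2 : RepA2 ρ D ρinv)
    {h : ℝ → ℝ} {S : Set ℝ} (hS : S.Finite) (hcont : ContinuousOn h D)
    (hderiv : ∀ z ∈ D \ S, HasDerivWithinAt h ((deriv ρinv z) ^ 2) D z)
    {K : (Fin M → ℝ) → ℝ} (hK : Differentiable ℝ K) (A : Matrix (Fin M) (Fin N) ℝ)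
    {T : ℝ≥0∞} {w : ℝ → Fin N → ℝ}
    (hflow : IsGradFlowOn (fun z => K (A.mulVec fun i => ρ (z i))) T w)
    (hreg : RegularFlow ρ T w) {u : Fin N → ℝ} (hu : A.mulVec u = 0)
    {t : ℝ} (ht : 0 ≤ t) (htT : ENNReal.ofReal t < T) :
    ∑ i, u i * h (ρ (w t i)) = ∑ i, u i * h (ρ (w 0 i)) := by
  have hlt : ∀ s ≤ t, ENNReal.ofReal s < T := fun s hs =>
    (ENNReal.ofReal_le_ofReal hs).trans_lt htT
  have hg : Continuous fun x => h (ρ x) :=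
    hcont.comp_continuous hA2.contDiff.continuous hA2.mapsTo
  have hw : ContinuousOn w (Icc 0 t) := fun s hs =>
    (hflow s hs.1 (hlt s hs.2)).continuousWithinAt.mono Icc_subset_Ici_self
  have hφ : ContinuousOn (fun s => ∑ i, u i * h (ρ (w s i))) (Icc 0 t) :=
    continuousOn_finsetSum _ fun i _ => continuousOn_const.mul
      (hg.comp_continuousOn ((continuous_apply i).comp_continuousOn hw))
  have hint := MeasureTheory.integral_eq_of_hasDerivAt_off_countable_of_le
    (fun s => ∑ i, u i * h (ρ (w s i))) (fun _ => 0) ht hreg.countable hφ ?_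
    intervalIntegrable_const
  · rw [intervalIntegral.integral_zero] at hint
    linarith
  rintro s ⟨hs, hcrit⟩
  have hne : ∀ i, deriv ρ (w s i) ≠ 0 := fun i hi =>
    hcrit ⟨hs.1.le, hlt s hs.2.le, i, hi⟩
  have hws := hasDerivAt_pi.1 ((hflow s hs.1.le (hlt s hs.2.le)).hasDerivAt (Ici_mem_nhds hs.1))
  have hG : Differentiable ℝ fun z => K (A.mulVec z) :=
    hK.comp (Matrix.mulVecLin A).toContinuousLinearMap.differentiable
  have hsum := HasDerivAt.fun_sum (u := Finset.univ) fun i _ =>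
    ((hA2.hasDerivAt_comp hS hcont hderiv (hne i)).comp s (hws i)).const_mul (u i)
  refine hsum.congr_deriv ?_
  have hker := sum_mul_grad (fun z => K (A.mulVec z)) (fun i => ρ (w s i)) u
  rw [fderiv_comp_mulVec_eq_zero A _ _ hK.differentiableAt hu] at hker
  rw [← neg_zero (G := ℝ), ← hker, ← Finset.sum_neg_distrib]
  refine Finset.sum_congr rfl fun i _ => ?_
  rw [Pi.neg_apply, grad_comp_entrywise (G := fun z => K (A.mulVec z)) (w s) hG.differentiableAt
    (fun i => (hA2.hasDerivAt _).differentiableAt) i]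
  have := hne i
  field_simp

theorem EReal.coe_finsetSum {ι : Type*} (s : Finset ι) (f : ι → ℝ) :
    ((∑ i ∈ s, f i : ℝ) : EReal) = ∑ i ∈ s, (f i : EReal) :=
  map_sum (⟨⟨Real.toEReal, EReal.coe_zero⟩, EReal.coe_add⟩ : ℝ →+ EReal) f s

theorem EReal.sum_sub_coe {ι : Type*} (s : Finset ι) (f : ι → EReal) (g : ι → ℝ) :
    ∑ i ∈ s, (f i - (g i : EReal)) = ∑ i ∈ s, f i + ((-∑ i ∈ s, g i : ℝ) : EReal) := by
  simp only [sub_eq_add_neg, Finset.sum_add_distrib, ← EReal.coe_neg, ← EReal.coe_finsetSum,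
    Finset.sum_neg_distrib]

/-- Implicit bias of reparametrized gradient flow: the limit of the
reparametrized trajectory minimizes `⟨1, H(z̃) - z̃ ⊙ h(w̃₀)⟩` over the reparametrized
global minimizers of the loss, and this is equivalent to minimizing the Bregman divergence
`D_F(z̃, w̃₀)` (both extended to `closure(D_rp)^N` with values in `EReal`). -/
theorem statement3 {N M : ℕ} (ρ ρinv : ℝ → ℝ) (D : Set ℝ) (hA2 : RepA2 ρ D ρinv)
    (ρlink : ℝ → ℝ) (y : Fin M → ℝ) (hA1 : LinkA1 ρlink y)
    (A : Matrix (Fin M) (Fin N) ℝ)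
    (L : (Fin M → ℝ) → (Fin M → ℝ) → ℝ) (hA3 : LossA3 L)
    (T : ℝ≥0∞) (hT : 0 < T) (w : ℝ → Fin N → ℝ)
    (hflow : IsGradFlowOn
      (fun z => L (fun j => ρlink ((A.mulVec fun i => ρ (z i)) j)) y) T w)
    (hreg : RegularFlow ρ T w)
    (h H : ℝ → ℝ) (S : Set ℝ) (hS : S.Finite)
    (hcont : ContinuousOn h D) (hHcont : ContinuousOn H D)
    (hderiv : ∀ z ∈ D \ S, HasDerivWithinAt h ((deriv ρinv z) ^ 2) D z)
    (hHderiv : ∀ z ∈ D, HasDerivWithinAt H (h z) D z)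
    (wT : Fin N → ℝ) (hlim : Tendsto w (endFilter T) (𝓝 wT))
    (hzero : L (fun j => ρlink ((A.mulVec fun i => ρ (wT i)) j)) y = 0)
    (hcase : (∀ i, ρ (wT i) ∈ D) ∨
      (∃ Hc hc : ℝ → ℝ, ContinuousOn Hc (closure D) ∧ Set.EqOn Hc H D ∧
        ContinuousOn hc (closure D) ∧ Set.EqOn hc h D))
    (Hbar : ℝ → EReal)
    (hHbar : ∀ x ∈ closure D,
      Tendsto (fun z => ((H z : ℝ) : EReal)) (𝓝[D] x) (𝓝 (Hbar x))) :
    (∀ zt : Fin N → ℝ, (∀ i, zt i ∈ closure D) →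
      L (fun j => ρlink (A.mulVec zt j)) y = 0 →
      (∑ i, (Hbar (ρ (wT i)) - ((ρ (wT i) * h (ρ (w 0 i)) : ℝ) : EReal))) ≤
        ∑ i, (Hbar (zt i) - ((zt i * h (ρ (w 0 i)) : ℝ) : EReal))) ∧
    ({zt : Fin N → ℝ | (∀ i, zt i ∈ closure D) ∧
        L (fun j => ρlink (A.mulVec zt j)) y = 0 ∧
        ∀ u : Fin N → ℝ, (∀ i, u i ∈ closure D) →
          L (fun j => ρlink (A.mulVec u j)) y = 0 →
          (∑ i, (Hbar (zt i) - ((zt i * h (ρ (w 0 i)) : ℝ) : EReal))) ≤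
            ∑ i, (Hbar (u i) - ((u i * h (ρ (w 0 i)) : ℝ) : EReal))} =
      {zt : Fin N → ℝ | (∀ i, zt i ∈ closure D) ∧
        L (fun j => ρlink (A.mulVec zt j)) y = 0 ∧
        ∀ u : Fin N → ℝ, (∀ i, u i ∈ closure D) →
          L (fun j => ρlink (A.mulVec u j)) y = 0 →
          (∑ i, (Hbar (zt i) -
            ((H (ρ (w 0 i)) + h (ρ (w 0 i)) * (zt i - ρ (w 0 i)) : ℝ) : EReal))) ≤
            ∑ i, (Hbar (u i) -
              ((H (ρ (w 0 i)) + h (ρ (w 0 i)) * (u i - ρ (w 0 i)) : ℝ) : EReal))}) := by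
  set K : (Fin M → ℝ) → ℝ := fun v => L (fun j => ρlink (v j)) y
  have hK : Differentiable ℝ K := by
    have hlink : Differentiable ℝ ρlink := hA1.contDiff.differentiable one_ne_zero
    have hpair : Differentiable ℝ fun v : Fin M → ℝ => (fun j => ρlink (v j), y) :=
      (differentiable_pi.2 fun j => hlink.comp (differentiable_apply j)).prodMk
        (differentiable_const y)
    exact (hA3.contDiff.differentiable one_ne_zero).comp hpair
  have hρ : Continuous ρ := hA2.contDiff.continuous
  have hmono := hA2.monotoneOn hS hcont hderiv
  have hHbarD : ∀ x ∈ D, Hbar x = (H x : EReal) := by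
    intro x hx
    have := mem_closure_iff_nhdsWithin_neBot.1 (subset_closure hx)
    exact tendsto_nhds_unique (hHbar x (subset_closure hx))
      ((continuous_coe_real_ereal.tendsto _).comp (hHcont x hx))
  have hzeroEq : ∀ {z z' : Fin N → ℝ}, K (A.mulVec z) = 0 → K (A.mulVec z') = 0 →
      A.mulVec z = A.mulVec z' := by
    intro z z' hz hz'
    have e := ((hA3.eq_zero_iff _ _).1 hz).trans ((hA3.eq_zero_iff _ _).1 hz').symm
    exact funext fun j => hA1.injective (congrFun e j)
  refine ⟨fun zt hzt hzt0 => ?_, ?_⟩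
  · have hker : A.mulVec (fun i => zt i - ρ (wT i)) = 0 :=
      (A.mulVec_sub zt fun i => ρ (wT i)).trans (sub_eq_zero.2 (hzeroEq hzt0 hzero))
    have hneBot := endFilter_neBot T
    have horth : ∑ i, (zt i - ρ (wT i)) * h (ρ (wT i)) =
        ∑ i, (zt i - ρ (wT i)) * h (ρ (w 0 i)) := by
      have hg : Continuous fun x => h (ρ x) := hcont.comp_continuous hρ hA2.mapsTo
      have hpair : Continuous fun z : Fin N → ℝ => ∑ i, (zt i - ρ (wT i)) * h (ρ (z i)) :=
        continuous_finsetSum _ fun i _ => continuous_const.mul (hg.comp (continuous_apply i))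
      refine tendsto_nhds_unique ((hpair.tendsto wT).comp hlim)
        (tendsto_const_nhds.congr' ?_)
      filter_upwards [eventually_endFilter hT] with t ht
      exact (sum_mul_mirror_eq hA2 hS hcont hderiv hK A hflow hreg hker ht.1 ht.2).symm
    have htan : ∀ i, ((H (ρ (wT i)) + h (ρ (wT i)) * (zt i - ρ (wT i)) : ℝ) : EReal) ≤
        Hbar (zt i) := fun i =>
      tangent_le_of_tendsto
        (fun z hz => hmono.tangent_le hA2.ordConnected hHderiv (hA2.mapsTo _) hz)
        (hzt i) (hHbar _ (hzt i))
    have hsum := Finset.sum_le_sum fun i (_ : i ∈ Finset.univ) => htan i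
    rw [EReal.sum_sub_coe, EReal.sum_sub_coe]
    refine le_trans (le_of_eq ?_) (add_le_add_left hsum _)
    simp only [fun i => hHbarD _ (hA2.mapsTo (wT i)), ← EReal.coe_finsetSum, ← EReal.coe_add]
    congr 1
    simp only [sub_mul, Finset.sum_sub_distrib] at horth
    simp only [mul_sub, Finset.sum_add_distrib, Finset.sum_sub_distrib]
    simp only [mul_comm (h _)]
    linarith
  · have hshift : ∀ zt : Fin N → ℝ,
        ∑ i, (Hbar (zt i) -
          ((H (ρ (w 0 i)) + h (ρ (w 0 i)) * (zt i - ρ (w 0 i)) : ℝ) : EReal)) =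
        ∑ i, (Hbar (zt i) - ((zt i * h (ρ (w 0 i)) : ℝ) : EReal)) +
          ((-∑ i, (H (ρ (w 0 i)) - h (ρ (w 0 i)) * ρ (w 0 i)) : ℝ) : EReal) := by
      intro zt
      rw [EReal.sum_sub_coe, EReal.sum_sub_coe, add_assoc, ← EReal.coe_add, ← neg_add,
        ← Finset.sum_add_distrib]
      congr 4
      funext i
      ring
    simp only [hshift, (EReal.addLECancellable_coe _).add_le_add_iff_right]
end
end
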